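/- arXiv:2409.04686 — 2 statements merged into one kernel-verified Lean document; each statement's English description precedes it below -/
import Mathlib

section
/- Let (R, m) be a commutative Noetherian local ring of depth t and let M be a finitely generated R-module. If Ext^i_R(M, R) = 0 for all 1 ≤ i ≤ t−1 and M^* ∈ DF(R), then R is a direct summand of M. -/
open IsLocalRing

universe u v

/-- The depth of a module `M` over a Noetherian local ring `(R, m)`: the supremum of the
lengths of `M`-regular sequences consisting of elements of `m`. -/
noncomputable def rdepth (R : Type*) (M : Type*) [CommRing R] [IsLocalRing R]
    [AddCommGroup M] [Module R M] : ℕ :=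
  sSup {n : ℕ | ∃ rs : List R, rs.length = n ∧ (∀ r ∈ rs, r ∈ maximalIdeal R) ∧
    RingTheory.Sequence.IsRegular M rs}

/-- `Deep(R)`: the class of finitely generated `R`-modules `M` with `depth_R(M) ≥ depth(R)`. -/
def Deep (R : Type*) (M : Type*) [CommRing R] [IsLocalRing R]
    [AddCommGroup M] [Module R M] : Prop :=
  Module.Finite R M ∧ rdepth R R ≤ rdepth R M

/-- `DF(R)` ("deeply faithful"): the class of finitely generated `R`-modules `M` admitting an
exact sequence `0 → R → M^{⊕n} → X → 0` with `X ∈ Deep(R)`. -/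
def DF (R : Type u) (M : Type v) [CommRing R] [IsLocalRing R]
    [AddCommGroup M] [Module R M] : Prop :=
  ∃ (n : ℕ) (X : Type v) (_ : AddCommGroup X) (_ : Module R X)
    (f : R →ₗ[R] (Fin n → M)) (g : (Fin n → M) →ₗ[R] X),
      Function.Injective f ∧ Function.Surjective g ∧ Function.Exact f g ∧ Deep R X

/-- The Ext module `Ext^n_R(M, N)`, via the derived functor `Ext` of Mathlib. -/
noncomputable abbrev extModule (R : Type u) [CommRing R] (M N : Type u)
    [AddCommGroup M] [Module R M] [AddCommGroup N] [Module R N] (n : ℕ) : ModuleCat.{u} R :=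
  ((Ext R (ModuleCat.{u} R) n).obj (Opposite.op (ModuleCat.of R M))).obj (ModuleCat.of R N)

open CategoryTheory Pointwise RingTheory.Sequence

section Modules

variable {R : Type u} [CommRing R]

/-- The condition, in terms of a projective resolution `(P, d)` of `M`, that
`Ext^(i+1)(M, N)` vanishes: every `(i+1)`-cocycle with values in `N` is a coboundary. -/
def CocyclesExtend (P : ℕ → Type u) [∀ i, AddCommGroup (P i)] [∀ i, Module R (P i)]
    (d : ∀ i, P (i + 1) →ₗ[R] P i) (N : Type u) [AddCommGroup N] [Module R N] (i : ℕ) : Prop :=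
  ∀ g : P (i + 1) →ₗ[R] N, g ∘ₗ d (i + 1) = 0 → ∃ h : P i →ₗ[R] N, g = h ∘ₗ d i

lemma mkQ_smul_top_eq_zero_iff {N : Type*} [AddCommGroup N] [Module R N] (x : R) (y : N) :
    (x • (⊤ : Submodule R N)).mkQ y = 0 ↔ ∃ z, x • z = y := by
  simp [Submodule.mem_smul_pointwise_iff_exists]

/-- A linear map with values in `x • N` factors through multiplication by `x` when `x` is
regular on `N`. -/
lemma IsSMulRegular.exists_eq_smul_of_mkQ_comp_eq_zero {P N : Type*} [AddCommGroup P]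
    [Module R P] [AddCommGroup N] [Module R N] {x : R} (hx : IsSMulRegular N x) (g : P →ₗ[R] N)
    (hg : (x • (⊤ : Submodule R N)).mkQ ∘ₗ g = 0) : ∃ k : P →ₗ[R] N, g = x • k := by
  choose k hk using fun p ↦ (mkQ_smul_top_eq_zero_iff x (g p)).1 (LinearMap.congr_fun hg p)
  refine ⟨{ toFun := k, map_add' := fun a b ↦ hx ?_, map_smul' := fun r a ↦ hx ?_ }, ?_⟩
  · simp [smul_add, hk]
  · simp only [hk, map_smul, RingHom.id_apply, smul_comm x r]
  · ext p; simp [hk]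

section Resolution

variable {P : ℕ → Type u} [∀ i, AddCommGroup (P i)] [∀ i, Module R (P i)]
  [∀ i, Module.Projective R (P i)] {d : ∀ i, P (i + 1) →ₗ[R] P i}
  {N : Type u} [AddCommGroup N] [Module R N]

/-- A map to `N / xN` whose lift becomes a cocycle modulo `x` can be lifted to `N` in such a way
that it kills the boundaries. -/
lemma CocyclesExtend.exists_lift (hd : ∀ i, d i ∘ₗ d (i + 1) = 0) {x : R}
    (hx : IsSMulRegular N x) {i : ℕ} (h : CocyclesExtend P d N i)
    (g : P i →ₗ[R] QuotSMulTop x N) (hg : g ∘ₗ d i = 0) :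
    ∃ G : P i →ₗ[R] N, (x • (⊤ : Submodule R N)).mkQ ∘ₗ G = g ∧ G ∘ₗ d i = 0 := by
  obtain ⟨G, hG⟩ := Module.projective_lifting_property (x • (⊤ : Submodule R N)).mkQ g
    (Submodule.mkQ_surjective _)
  obtain ⟨k, hk⟩ := hx.exists_eq_smul_of_mkQ_comp_eq_zero (G ∘ₗ d i)
    (by rw [← LinearMap.comp_assoc, hG, hg])
  have hkd : k ∘ₗ d (i + 1) = 0 := by
    ext p
    refine hx ?_
    have h1 := LinearMap.congr_fun hk (d (i + 1) p)
    have h2 : d i (d (i + 1) p) = 0 := LinearMap.congr_fun (hd i) p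
    simpa [h2] using h1.symm
  obtain ⟨l, rfl⟩ := h k hkd
  refine ⟨G - x • l, ?_, ?_⟩
  · ext p
    have h1 := LinearMap.congr_fun hG p
    have h2 : (x • (⊤ : Submodule R N)).mkQ (x • l p) = 0 :=
      (mkQ_smul_top_eq_zero_iff _ _).2 ⟨_, rfl⟩
    simp only [LinearMap.comp_apply] at h1
    simp only [LinearMap.comp_apply, LinearMap.sub_apply, LinearMap.smul_apply, map_sub, h1, h2,
      sub_zero]
  · rw [LinearMap.sub_comp, hk, LinearMap.smul_comp, sub_self]

lemma CocyclesExtend.quotSMulTop (hd : ∀ i, d i ∘ₗ d (i + 1) = 0) {x : R}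
    (hx : IsSMulRegular N x) {i : ℕ} (h : CocyclesExtend P d N i)
    (h' : CocyclesExtend P d N (i + 1)) : CocyclesExtend P d (QuotSMulTop x N) i := by
  intro g hg
  obtain ⟨G, rfl, hGd⟩ := h'.exists_lift hd hx g hg
  obtain ⟨l, rfl⟩ := h G hGd
  exact ⟨_, (LinearMap.comp_assoc _ _ _).symm⟩

lemma CocyclesExtend.exists_lift_of_augmentation {M : Type*} [AddCommGroup M] [Module R M]
    {ε : P 0 →ₗ[R] M} (hε : Function.Surjective ε) (hdε : Function.Exact (d 0) ε)
    (hd : ∀ i, d i ∘ₗ d (i + 1) = 0) {x : R}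
    (hx : IsSMulRegular N x) (h : CocyclesExtend P d N 0) (g : M →ₗ[R] QuotSMulTop x N) :
    ∃ G : M →ₗ[R] N, (x • (⊤ : Submodule R N)).mkQ ∘ₗ G = g := by
  obtain ⟨G, hG, hGd⟩ := h.exists_lift hd hx (g ∘ₗ ε)
    (by rw [LinearMap.comp_assoc, hdε.linearMap_comp_eq_zero, LinearMap.comp_zero])
  have hker : LinearMap.ker ε ≤ LinearMap.ker G := by
    intro p hp
    obtain ⟨q, rfl⟩ := (hdε p).1 hp
    exact LinearMap.congr_fun hGd q
  choose s hs using hε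
  have key : ∀ p, G (s (ε p)) = G p := fun p ↦ by
    rw [← sub_eq_zero, ← map_sub]
    exact hker (by simp [hs])
  refine ⟨{ toFun := fun m ↦ G (s m), map_add' := fun a b ↦ ?_, map_smul' := fun r a ↦ ?_ }, ?_⟩
  · rw [← map_add, ← key (s a + s b), map_add, hs, hs]
  · rw [RingHom.id_apply, ← map_smul, ← key (r • s a), map_smul, hs]
  · ext m
    simpa [hs] using LinearMap.congr_fun hG (s m)

end Resolution

end Modules

/-- Vanishing of `Ext^(i+1)(M, N)` in terms of a given projective resolution. -/
lemma cocyclesExtend_of_subsingleton_extModule {R : Type u} [CommRing R] {M N : Type u}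
    [AddCommGroup M] [Module R M] [AddCommGroup N] [Module R N]
    (Q : ProjectiveResolution (ModuleCat.of R M)) (i : ℕ)
    (h : Subsingleton (extModule R M N (i + 1))) :
    CocyclesExtend (fun j ↦ Q.complex.X j) (fun j ↦ (Q.complex.d (j + 1) j).hom) N i := by
  have hz : Limits.IsZero ((Q.complex.linearYonedaObj R (ModuleCat.of R N)).homology (i + 1)) :=
    (ModuleCat.isZero_of_subsingleton _).of_iso
      (Q.isoExt (R := R) (i + 1) (ModuleCat.of R N)).symm
  rw [← HomologicalComplex.exactAt_iff_isZero_homology,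
    HomologicalComplex.exactAt_iff' _ i (i + 1) (i + 2) (by simp) (by simp),
    ShortComplex.moduleCat_exact_iff] at hz
  intro g hg
  obtain ⟨l, hl⟩ := hz (ModuleCat.ofHom g) (by
    change Q.complex.d (i + 2) (i + 1) ≫ ModuleCat.ofHom g = 0
    ext1
    exact hg)
  refine ⟨(show Q.complex.X i ⟶ ModuleCat.of R N from l).hom, ?_⟩
  have hl' : Q.complex.d (i + 1) i ≫ (show Q.complex.X i ⟶ ModuleCat.of R N from l)
    = ModuleCat.ofHom g := hl
  exact (congrArg ModuleCat.Hom.hom hl').symm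

section Depth

variable {R : Type u} [CommRing R] [IsLocalRing R]

lemma subsingleton_linearMap_residue_of_forall {N : Type*} [AddCommGroup N] [Module R N]
    (h : ∀ y : N, (∀ a ∈ maximalIdeal R, a • y = 0) → y = 0) :
    Subsingleton ((R ⧸ maximalIdeal R) →ₗ[R] N) := by
  refine subsingleton_of_forall_eq 0 fun f ↦ ?_
  apply Submodule.linearMap_qext
  ext
  refine h _ fun a ha ↦ ?_
  change a • f (Submodule.Quotient.mk 1) = 0
  rw [← map_smul, ← Submodule.Quotient.mk_smul, (Submodule.Quotient.mk_eq_zero _).2, map_zero]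
  simpa using ha

lemma exists_isSMulRegular_of_subsingleton [IsNoetherianRing R] {N : Type*} [AddCommGroup N]
    [Module R N] [Module.Finite R N] (h : Subsingleton ((R ⧸ maximalIdeal R) →ₗ[R] N)) :
    ∃ x ∈ maximalIdeal R, IsSMulRegular N x := by
  simpa [Ideal.annihilator_quotient] using IsSMulRegular.subsingleton_linearMap_iff.1 h

lemma exists_isSMulRegular_of_subsingleton₂ [IsNoetherianRing R] {N X : Type*} [AddCommGroup N]
    [Module R N] [Module.Finite R N] [AddCommGroup X] [Module R X] [Module.Finite R X]
    (hN : Subsingleton ((R ⧸ maximalIdeal R) →ₗ[R] N))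
    (hX : Subsingleton ((R ⧸ maximalIdeal R) →ₗ[R] X)) :
    ∃ x ∈ maximalIdeal R, IsSMulRegular N x ∧ IsSMulRegular X x := by
  obtain ⟨x, hx, hreg⟩ := exists_isSMulRegular_of_subsingleton (R := R) (N := N × X)
    ((LinearMap.prodEquiv (M := R ⧸ maximalIdeal R) R).symm.toEquiv.subsingleton)
  refine ⟨x, hx, fun a b hab ↦ ?_, fun a b hab ↦ ?_⟩
  · have : (a, (0 : X)) = (b, 0) := hreg (Prod.ext hab rfl)
    exact congrArg Prod.fst this
  · have : ((0 : N), a) = (0, b) := hreg (Prod.ext rfl hab)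
    exact congrArg Prod.snd this

/-- Homological form of `depth X ≥ s`: `Ext^i(k, X) = 0` for `i < s`, where `k` is the residue
field. -/
def ResidueExtVanish (R : Type u) [CommRing R] [IsLocalRing R] (X : Type u) [AddCommGroup X]
    [Module R X] (s : ℕ) : Prop :=
  ∀ i < s, Subsingleton
    (Abelian.Ext (ModuleCat.of R (R ⧸ maximalIdeal R)) (ModuleCat.of R X) i)

lemma ResidueExtVanish.subsingleton_linearMap {X : Type u} [AddCommGroup X] [Module R X] {s : ℕ}
    (h : ResidueExtVanish R X (s + 1)) : Subsingleton ((R ⧸ maximalIdeal R) →ₗ[R] X) := by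
  have : Subsingleton (ModuleCat.of R (R ⧸ maximalIdeal R) ⟶ ModuleCat.of R X) :=
    Abelian.Ext.addEquiv₀.subsingleton_congr.1 (h 0 s.succ_pos)
  exact (ModuleCat.homAddEquiv (M := .of R (R ⧸ maximalIdeal R)) (N := .of R X)).symm.subsingleton

lemma ResidueExtVanish.quotSMulTop {X : Type u} [AddCommGroup X] [Module R X] {s : ℕ}
    (h : ResidueExtVanish R X (s + 1)) {x : R} (hx : IsSMulRegular X x) :
    ResidueExtVanish R (QuotSMulTop x X) s := by
  intro i hi
  have zero1 := AddCommGrpCat.isZero_of_iff_subsingleton.mpr (h i (by omega))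
  have zero2 := AddCommGrpCat.isZero_of_iff_subsingleton.mpr (h (i + 1) (by omega))
  have hx' : IsSMulRegular (ModuleCat.of R X) x := hx
  exact AddCommGrpCat.subsingleton_of_isZero <| ShortComplex.Exact.isZero_of_both_zeros
    ((Abelian.Ext.covariant_sequence_exact₃' (ModuleCat.of R (R ⧸ maximalIdeal R))
      hx'.smulShortComplex_shortExact) i (i + 1) rfl)
    (zero1.eq_zero_of_src _) (zero2.eq_zero_of_tgt _)

lemma residueExtVanish_of_isRegular [IsNoetherianRing R] {X : Type u} [AddCommGroup X]
    [Module R X] [Module.Finite R X] {rs : List R} (hmem : ∀ r ∈ rs, r ∈ maximalIdeal R)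
    (hreg : IsRegular X rs) : ResidueExtVanish R X rs.length := by
  have := hreg.nontrivial
  refine ModuleCat.subsingleton_ext_of_exists_isRegular (maximalIdeal R) _ ?_ _ ?_ rs hmem hreg
  · rw [Module.support_eq_zeroLocus, Ideal.annihilator_quotient]
  · exact (Submodule.top_ne_ideal_smul_of_le_jacobson_annihilator
      (maximalIdeal_le_jacobson _)).symm.lt_top

lemma residueExtVanish_of_le_rdepth [IsNoetherianRing R] {X : Type u} [AddCommGroup X]
    [Module R X] [Module.Finite R X] {s : ℕ} (hs : s ≤ rdepth R X) : ResidueExtVanish R X s := by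
  rcases Nat.eq_zero_or_pos (rdepth R X) with h0 | hpos
  · intro i hi
    omega
  · have hmem := Nat.sSup_mem (s := {n : ℕ | ∃ rs : List R, rs.length = n ∧
      (∀ r ∈ rs, r ∈ maximalIdeal R) ∧ IsRegular X rs})
      (by
        by_contra hne
        rw [Set.not_nonempty_iff_eq_empty] at hne
        simp only [rdepth, hne, csSup_empty, bot_eq_zero', lt_self_iff_false] at hpos)
      (by
        by_contra hb
        have : rdepth R X = 0 := Nat.sSup_of_not_bddAbove hb
        omega)
    obtain ⟨rs, hlen, hrs, hreg⟩ := hmem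
    have hv := residueExtVanish_of_isRegular hrs hreg
    rw [hlen] at hv
    exact fun i hi ↦ hv i (hi.trans_le hs)

/-- The depth of a Noetherian local ring bounds the length of every regular sequence. -/
lemma length_le_rdepth_self [IsNoetherianRing R] {rs : List R}
    (hmem : ∀ r ∈ rs, r ∈ maximalIdeal R) (hreg : IsWeaklyRegular R rs) :
    rs.length ≤ rdepth R R := by
  refine le_csSup ?_ ⟨rs, rfl, hmem, .of_isWeaklyRegular_of_mem_maximalIdeal R hmem hreg⟩
  refine ⟨(maximalIdeal R).spanFinrank, ?_⟩
  rintro _ ⟨qs, rfl, -, hq⟩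
  have h1 := ringKrullDim_add_length_eq_ringKrullDim_of_isRegular qs hq
  have : Nontrivial (R ⧸ Ideal.ofList qs) := Ideal.Quotient.nontrivial_iff.2 fun h ↦
    hq.top_ne_smul (by simp [h])
  have h2 : (0 : WithBot ℕ∞) ≤ ringKrullDim (R ⧸ Ideal.ofList qs) :=
    ringKrullDim_nonneg_of_nontrivial
  have h3 : ((qs.length : ℕ) : WithBot ℕ∞) ≤ (maximalIdeal R).spanFinrank :=
    ((le_add_of_nonneg_left h2).trans h1.le).trans
      (ringKrullDim_le_spanFinrank_maximalIdeal R)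
  exact_mod_cast h3

/-- If functionals `f i : M → R` with values in the maximal ideal jointly act faithfully on `N`,
then `N` has trivial socle. -/
lemma subsingleton_linearMap_residue_of_injective {ι M N : Type*} [AddCommGroup M] [Module R M]
    [AddCommGroup N] [Module R N] {f : ι → M →ₗ[R] R} (hf : ∀ i m, f i m ∈ maximalIdeal R)
    (inj : ∀ y : N, (∀ i m, f i m • y = 0) → y = 0) :
    Subsingleton ((R ⧸ maximalIdeal R) →ₗ[R] N) :=
  subsingleton_linearMap_residue_of_forall fun y hy ↦ inj y fun i m ↦ hy _ (hf i m)

end Depth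

section Main

variable {R : Type u} [CommRing R]

/-- Injectivity of `N → Hom(M, N)^n` passes to `N / xN` when `x` is regular on `N` and on the
cokernel. -/
lemma eq_zero_of_quotSMulTop {ι M N X : Type*} [AddCommGroup M] [Module R M]
    [AddCommGroup N] [Module R N] [AddCommGroup X] [Module R X] {f : ι → M →ₗ[R] R}
    (inj : ∀ y : N, (∀ i m, f i m • y = 0) → y = 0) {θ : (ι → M →ₗ[R] N) →ₗ[R] X}
    (hθ : ∀ y : N, θ (fun i ↦ LinearMap.toSpanSingleton R N y ∘ₗ f i) = 0)
    (hex : ∀ h, θ h = 0 → ∃ y : N, ∀ i m, h i m = f i m • y)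
    {x : R} (hN : IsSMulRegular N x) (hX : IsSMulRegular X x) (y : QuotSMulTop x N)
    (hy : ∀ i m, f i m • y = 0) : y = 0 := by
  obtain ⟨y, rfl⟩ := Submodule.mkQ_surjective _ y
  have hk : ∀ i, ∃ k : M →ₗ[R] N, LinearMap.toSpanSingleton R N y ∘ₗ f i = x • k := fun i ↦
    hN.exists_eq_smul_of_mkQ_comp_eq_zero _ (by
      ext m
      rw [LinearMap.comp_apply, LinearMap.comp_apply, LinearMap.toSpanSingleton_apply, map_smul]
      exact hy i m)
  choose k hk using hk
  have hθk : θ k = 0 := hX (by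
    change x • θ k = x • (0 : X)
    rw [smul_zero, ← map_smul, ← hθ y]
    exact congrArg θ (funext fun i ↦ (hk i).symm))
  obtain ⟨z, hz⟩ := hex k hθk
  refine (mkQ_smul_top_eq_zero_iff x y).2 ⟨z, ?_⟩
  rw [eq_comm, ← sub_eq_zero]
  refine inj _ fun i m ↦ ?_
  have h1 := LinearMap.congr_fun (hk i) m
  simp only [LinearMap.comp_apply, LinearMap.toSpanSingleton_apply, LinearMap.smul_apply, hz] at h1
  rw [smul_sub, h1, smul_comm, sub_self]

/-- If `Hom(M, N) → Hom(M, N / xN)` is surjective and `x` is `N`-regular, a presentation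
`N → Hom(M, N)^n → X → 0` induces one for `N / xN` and `X / xX`. -/
lemma exists_presentation_quotSMulTop {ι M N X : Type*} [AddCommGroup M]
    [Module R M] [AddCommGroup N] [Module R N] [AddCommGroup X] [Module R X]
    {f : ι → M →ₗ[R] R} {θ : (ι → M →ₗ[R] N) →ₗ[R] X} (surj : Function.Surjective θ)
    (hθ : ∀ y : N, θ (fun i ↦ LinearMap.toSpanSingleton R N y ∘ₗ f i) = 0)
    (hex : ∀ h, θ h = 0 → ∃ y : N, ∀ i m, h i m = f i m • y)
    {x : R} (hN : IsSMulRegular N x)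
    (lift : ∀ g : M →ₗ[R] QuotSMulTop x N,
      ∃ G : M →ₗ[R] N, (x • (⊤ : Submodule R N)).mkQ ∘ₗ G = g) :
    ∃ θ' : (ι → M →ₗ[R] QuotSMulTop x N) →ₗ[R] QuotSMulTop x X, Function.Surjective θ' ∧
      (∀ y, θ' (fun i ↦ LinearMap.toSpanSingleton R _ y ∘ₗ f i) = 0) ∧
      ∀ h, θ' h = 0 → ∃ y : QuotSMulTop x N, ∀ i m, h i m = f i m • y := by
  let π : (ι → M →ₗ[R] N) →ₗ[R] (ι → M →ₗ[R] QuotSMulTop x N) :=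
    (((x • (⊤ : Submodule R N)).mkQ).compRight R).compLeft ι
  have hπ : ∀ h i, π h i = (x • (⊤ : Submodule R N)).mkQ ∘ₗ h i := fun _ _ ↦ rfl
  have πsurj : Function.Surjective π := fun g ↦ by
    choose G hG using fun i ↦ lift (g i)
    exact ⟨G, funext hG⟩
  let τ : (ι → M →ₗ[R] N) →ₗ[R] QuotSMulTop x X := (x • (⊤ : Submodule R X)).mkQ ∘ₗ θ
  have hker : LinearMap.ker π ≤ LinearMap.ker τ := by
    intro h hh
    choose k hk using fun i ↦ hN.exists_eq_smul_of_mkQ_comp_eq_zero (h i) (congrFun hh i)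
    refine (mkQ_smul_top_eq_zero_iff x _).2 ⟨θ k, ?_⟩
    rw [← map_smul]
    exact congrArg θ (funext fun i ↦ (hk i).symm)
  obtain ⟨θ', hθ'⟩ : ∃ θ' : (ι → M →ₗ[R] QuotSMulTop x N) →ₗ[R] QuotSMulTop x X,
      θ' ∘ₗ π = τ := by
    refine ⟨(LinearMap.ker π).liftQ τ hker ∘ₗ
      (π.quotKerEquivOfSurjective πsurj).symm.toLinearMap, ?_⟩
    ext1 h
    have : (π.quotKerEquivOfSurjective πsurj).symm (π h) = (LinearMap.ker π).mkQ h := by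
      rw [LinearEquiv.symm_apply_eq]; rfl
    simp only [LinearMap.comp_apply, LinearEquiv.coe_coe, this, Submodule.mkQ_apply,
      Submodule.liftQ_apply]
  have hθ'π : ∀ h, θ' (π h) = (x • (⊤ : Submodule R X)).mkQ (θ h) := LinearMap.congr_fun hθ'
  refine ⟨θ', fun z ↦ ?_, fun y ↦ ?_, fun h hh ↦ ?_⟩
  · obtain ⟨z, rfl⟩ := Submodule.mkQ_surjective _ z
    obtain ⟨h, rfl⟩ := surj z
    exact ⟨π h, hθ'π h⟩
  · obtain ⟨y, rfl⟩ := Submodule.mkQ_surjective _ y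
    have h1 := hθ'π (fun i ↦ LinearMap.toSpanSingleton R N y ∘ₗ f i)
    rw [hθ, map_zero] at h1
    rw [← h1]
    congr 1
  · obtain ⟨h, rfl⟩ := πsurj h
    rw [hθ'π, mkQ_smul_top_eq_zero_iff] at hh
    obtain ⟨z, hz⟩ := hh
    obtain ⟨k, rfl⟩ := surj z
    obtain ⟨y, hy⟩ := hex (h - x • k) (by rw [map_sub, map_smul, hz, sub_self])
    refine ⟨(x • (⊤ : Submodule R N)).mkQ y, fun i m ↦ ?_⟩
    rw [hπ, LinearMap.comp_apply, ← map_smul, ← hy, ← sub_eq_zero, ← map_sub]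
    exact (mkQ_smul_top_eq_zero_iff _ _).2 ⟨k i m, by simp⟩

/-- Suppose that `Ext^j(M, N) = 0` for `1 ≤ j ≤ s` and that there is an exact sequence
`0 → N → Hom(M, N)^n → X → 0` whose first map is induced by functionals on `M` with values in
the maximal ideal. If `depth X ≥ s + 1`, then `depth N ≥ s + 2`. -/
lemma exists_isWeaklyRegular_of_exact [IsNoetherianRing R] [IsLocalRing R]
    {ι : Type*} {M : Type u} [AddCommGroup M] [Module R M]
    {P : ℕ → Type u} [∀ i, AddCommGroup (P i)] [∀ i, Module R (P i)]
    [∀ i, Module.Projective R (P i)] {d : ∀ i, P (i + 1) →ₗ[R] P i}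
    (hd : ∀ i, d i ∘ₗ d (i + 1) = 0) {ε : P 0 →ₗ[R] M} (hε : Function.Surjective ε)
    (hdε : Function.Exact (d 0) ε) {f : ι → M →ₗ[R] R} (hf : ∀ i m, f i m ∈ maximalIdeal R)
    (s : ℕ) {N X : Type u} [AddCommGroup N] [Module R N] [Module.Finite R N]
    [AddCommGroup X] [Module R X] [Module.Finite R X]
    (hV : ∀ i < s, CocyclesExtend P d N i)
    (inj : ∀ y : N, (∀ i m, f i m • y = 0) → y = 0)
    {θ : (ι → M →ₗ[R] N) →ₗ[R] X} (surj : Function.Surjective θ)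
    (hθ : ∀ y : N, θ (fun i ↦ LinearMap.toSpanSingleton R N y ∘ₗ f i) = 0)
    (hex : ∀ h, θ h = 0 → ∃ y : N, ∀ i m, h i m = f i m • y)
    (hX : ResidueExtVanish R X (s + 1)) :
    ∃ rs : List R, rs.length = s + 2 ∧ (∀ r ∈ rs, r ∈ maximalIdeal R) ∧
      IsWeaklyRegular N rs := by
  induction s generalizing N X with
  | zero =>
    obtain ⟨x, hx, hNx, hXx⟩ := exists_isSMulRegular_of_subsingleton₂
      (subsingleton_linearMap_residue_of_injective hf inj) hX.subsingleton_linearMap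
    obtain ⟨z, hz, hreg⟩ := exists_isSMulRegular_of_subsingleton
      (subsingleton_linearMap_residue_of_injective hf
        (eq_zero_of_quotSMulTop inj hθ hex hNx hXx))
    exact ⟨[x, z], rfl, by simpa using ⟨hx, hz⟩,
      .cons hNx ((isWeaklyRegular_singleton_iff _ _).2 hreg)⟩
  | succ s ih =>
    obtain ⟨x, hx, hNx, hXx⟩ := exists_isSMulRegular_of_subsingleton₂
      (subsingleton_linearMap_residue_of_injective hf inj) hX.subsingleton_linearMap
    obtain ⟨θ', surj', hθ', hex'⟩ := exists_presentation_quotSMulTop surj hθ hex hNx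
      ((hV 0 s.succ_pos).exists_lift_of_augmentation hε hdε hd hNx)
    obtain ⟨rs, hlen, hmem, hreg⟩ := ih
      (fun i hi ↦ (hV i (by omega)).quotSMulTop hd hNx (hV (i + 1) (by omega)))
      (eq_zero_of_quotSMulTop inj hθ hex hNx hXx) surj' hθ' hex' (hX.quotSMulTop hXx)
    exact ⟨x :: rs, by simp [hlen], by simpa using ⟨hx, hmem⟩, .cons hNx hreg⟩

end Main

/-- Let `(R, m)` be a commutative Noetherian local ring of depth `t` and let
`M` be a finitely generated `R`-module.  If `Ext^i_R(M, R) = 0` for all `1 ≤ i ≤ t−1` and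
`M^* ∈ DF(R)`, then `R` is a direct summand of `M`. -/
theorem free_summand_of_dual_DF {R : Type u} [CommRing R] [IsNoetherianRing R] [IsLocalRing R]
    (M : Type u) [AddCommGroup M] [Module R M] [Module.Finite R M]
    (hvanish : ∀ i : ℕ, 1 ≤ i → i ≤ rdepth R R - 1 → Subsingleton (extModule R M R i))
    (hDF : DF R (M →ₗ[R] R)) :
    ∃ (f : R →ₗ[R] M) (g : M →ₗ[R] R), g ∘ₗ f = LinearMap.id := by
  by_contra hsplit
  obtain ⟨n, X, _, _, F, θ, hF, surj, hex, hXfin, hX⟩ := hDF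
  let f : Fin n → M →ₗ[R] R := F 1
  have hFf : ∀ y i, F y i = LinearMap.toSpanSingleton R R y ∘ₗ F 1 i := fun y i ↦ by
    have h1 : F y = y • F 1 := by rw [← map_smul, smul_eq_mul, mul_one]
    ext m
    simp [h1, mul_comm]
  have hf : ∀ i m, f i m ∈ maximalIdeal R := by
    intro i m
    by_contra hu
    obtain ⟨v, hv⟩ := (notMem_maximalIdeal.1 hu).exists_left_inv
    exact hsplit ⟨LinearMap.toSpanSingleton R M (v • m), f i, by ext; simp [hv]⟩
  have inj : ∀ y : R, (∀ i m, f i m • y = 0) → y = 0 := fun y hy ↦ hF (by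
    ext i m
    simpa [hFf y i] using hy i m)
  rcases Nat.eq_zero_or_pos (rdepth R R) with h0 | hpos
  · obtain ⟨x, hx, hreg⟩ := exists_isSMulRegular_of_subsingleton
      (subsingleton_linearMap_residue_of_injective hf inj)
    have := length_le_rdepth_self (rs := [x]) (by simpa using hx)
      ((isWeaklyRegular_singleton_iff _ _).2 hreg)
    simp [h0] at this
  · obtain ⟨s, hs⟩ := Nat.exists_eq_add_of_lt hpos
    rw [zero_add] at hs
    obtain ⟨Q⟩ := (inferInstance : HasProjectiveResolution (ModuleCat.of R M)).out
    have (i : ℕ) : Module.Projective R (Q.complex.X i) :=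
      (IsProjective.iff_projective _).2 (Q.projective i)
    obtain ⟨rs, hlen, hmem, hreg⟩ := exists_isWeaklyRegular_of_exact
      (P := fun j ↦ Q.complex.X j) (d := fun j ↦ (Q.complex.d (j + 1) j).hom)
      (ε := (Q.π.f 0).hom) (N := R) (θ := θ)
      (fun i ↦ congrArg ModuleCat.Hom.hom (Q.complex.d_comp_d (i + 2) (i + 1) i))
      ((ModuleCat.epi_iff_surjective _).1 inferInstance)
      ((ShortComplex.ShortExact.moduleCat_exact_iff_function_exact _).1
        (ShortComplex.exact_of_g_is_cokernel
          (ShortComplex.mk (Q.complex.d 1 0) (Q.π.f 0) Q.complex_d_comp_π_f_zero)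
          Q.isColimitCokernelCofork))
      hf s
      (fun i hi ↦ cocyclesExtend_of_subsingleton_extModule Q i
        (hvanish (i + 1) (by omega) (by omega)))
      inj surj
      (fun y ↦ (hex _).2 ⟨y, funext fun i ↦ hFf y i⟩)
      (fun h hh ↦ by
        obtain ⟨y, hy⟩ := (hex _).1 hh
        refine ⟨y, fun i m ↦ ?_⟩
        have h1 := LinearMap.congr_fun (congrFun hy i) m
        rw [hFf] at h1
        exact h1.symm)
      (residueExtVanish_of_le_rdepth (hs ▸ hX))
    have := length_le_rdepth_self hmem hreg
    omega
end

section
/- Let (R, m) be a commutative Noetherian local ring of depth t and let M be a finitely generated R-module with Ext^i_R(M, R) = 0 for all 1 ≤ i ≤ t−1. If M^* is a free R-module, then M ≅ T ⊕ M^* for some finitely generated R-module T which is either 0 or has grade t. If, in addition, R is Cohen–Macaulay, then T has finite length. -/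
open IsLocalRing

universe u v

/-- The grade of an `R`-module `T`: the least `i` with `Ext^i_R(T, R) ≠ 0`. -/
noncomputable def gradeOf (R : Type u) [CommRing R] (T : Type u)
    [AddCommGroup T] [Module R T] : ℕ :=
  sInf {i : ℕ | ¬ Subsingleton (extModule R T R i)}

open CategoryTheory in
lemma subsingleton_extModule_iff {R : Type u} [CommRing R] (M N : Type u)
    [AddCommGroup M] [Module R M] [AddCommGroup N] [Module R N] (n : ℕ) :
    Subsingleton (extModule R M N n) ↔
      Subsingleton (Abelian.Ext (ModuleCat.of R M) (ModuleCat.of R N) n) := by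
  let P := projectiveResolution (ModuleCat.of R M)
  rw [← ModuleCat.isZero_iff_subsingleton, (P.isoExt n (ModuleCat.of R N)).isZero_iff,
    ← HomologicalComplex.exactAt_iff_isZero_homology]
  cases n with
  | zero =>
    rw [HomologicalComplex.exactAt_iff' _ 0 0 1 (by simp) (by simp),
      ShortComplex.moduleCat_exact_iff, Abelian.Ext.addEquiv₀.subsingleton_congr]
    constructor
    · intro h
      refine subsingleton_of_forall_eq 0 fun f ↦ ?_
      let π : P.complex.X 0 ⟶ ModuleCat.of R M := P.π.f 0
      have hπ : P.complex.d 1 0 ≫ π = 0 := P.complex_d_comp_π_f_zero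
      have : Epi π := inferInstanceAs (Epi (P.π.f 0))
      obtain ⟨g, hg⟩ := h (π ≫ f) (by
        change P.complex.d 1 0 ≫ π ≫ f = 0
        rw [← Category.assoc, hπ, Limits.zero_comp])
      rw [← cancel_epi π, ← hg, Limits.comp_zero]
      change P.complex.d 0 0 ≫ g = 0
      rw [P.complex.shape 0 0 (by simp)]
      exact Limits.zero_comp
    · intro h f hf
      let c := Limits.CokernelCofork.ofπ (f := P.complex.d 1 0) f hf
      have hfac := P.isColimitCokernelCofork.fac c Limits.WalkingParallelPair.one
      refine ⟨0, (map_zero _).trans ?_⟩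
      rw [h.elim (P.isColimitCokernelCofork.desc c) 0] at hfac
      exact Limits.comp_zero.symm.trans hfac
  | succ n =>
    rw [HomologicalComplex.exactAt_iff' _ n (n + 1) (n + 2) (by simp) (by simp),
      ShortComplex.moduleCat_exact_iff]
    constructor
    · intro h
      refine subsingleton_of_forall_eq 0 fun x ↦ ?_
      obtain ⟨f, hf, rfl⟩ := P.extMk_surjective x (n + 2) rfl
      exact (P.extMk_eq_zero_iff f _ rfl hf n rfl).mpr (h f hf)
    · intro h f hf
      exact (P.extMk_eq_zero_iff f (n + 2) rfl hf n rfl).mp (Subsingleton.elim _ _)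

open CategoryTheory Abelian in
lemma smul_ext_eq_zero_of_mem_annihilator {R : Type u} [CommRing R] {N M : ModuleCat.{u} R} {r : R}
    (hr : r ∈ Module.annihilator R N) {n : ℕ} (e : Ext N M n) : r • e = 0 := by
  have h : r • 𝟙 N = 0 := by
    simp [← ModuleCat.lsmul_eq_smul_id, Module.mem_annihilator_iff_lsmul_eq_zero.mp hr]
  have he : r • e = (Ext.mk₀ (r • 𝟙 N)).comp e (zero_add n) := by simp [Ext.mk₀_smul]
  simpa [h] using he

/-- If `Ext^i(C, X) = 0` for `i < a`, then `Ext^k(K, X)` vanishes as soon as it is killed by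
`Ann C`, where `k < a` is at most the grade of `K` on `X`. -/
lemma subsingleton_ext_of_annihilator_smul_eq_zero {R : Type u} [CommRing R] [IsNoetherianRing R]
    (C K : ModuleCat.{u} R) [Module.Finite R C] [Module.Finite R K] (k : ℕ) :
    ∀ (X : ModuleCat.{u} R) [Module.Finite R X] (a : ℕ), k < a →
      (∀ i < a, Subsingleton (CategoryTheory.Abelian.Ext C X i)) →
      (∀ i < k, Subsingleton (CategoryTheory.Abelian.Ext K X i)) →
      (∀ r ∈ Module.annihilator R C, ∀ e : CategoryTheory.Abelian.Ext K X k, r • e = 0) →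
      Subsingleton (CategoryTheory.Abelian.Ext K X k) := by
  open CategoryTheory Abelian in
  induction k with
  | zero =>
    intro X _ a ha hC _ hann
    have : Subsingleton (C ⟶ X) := Ext.addEquiv₀.subsingleton_congr.mp (hC 0 ha)
    have : Subsingleton (C →ₗ[R] X) := ModuleCat.homAddEquiv.symm.subsingleton
    obtain ⟨y, hy, hreg⟩ := IsSMulRegular.subsingleton_linearMap_iff.mp this
    refine subsingleton_of_forall_eq 0 fun e ↦ ?_
    obtain ⟨f, rfl⟩ := (Ext.mk₀_bijective K X).2 e
    have h := hann y hy (Ext.mk₀ f)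
    rw [← Ext.mk₀_smul, Ext.mk₀_eq_zero_iff] at h
    rw [Ext.mk₀_eq_zero_iff]
    ext x
    have hx : y • f.hom x = 0 := DFunLike.congr_fun (congrArg ModuleCat.Hom.hom h) x
    exact hreg.right_eq_zero_of_smul hx
  | succ k ih =>
    intro X _ a ha hC hK hann
    have : Subsingleton (K ⟶ X) := Ext.addEquiv₀.subsingleton_congr.mp (hK 0 k.succ_pos)
    have : Subsingleton (K →ₗ[R] X) := ModuleCat.homAddEquiv.symm.subsingleton
    obtain ⟨x, hx, hreg⟩ := IsSMulRegular.subsingleton_linearMap_iff.mp this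
    have hS := hreg.smulShortComplex_shortExact
    have shift : ∀ (N : ModuleCat.{u} R) (i : ℕ), Subsingleton (Ext N X i) →
        ∀ e : Ext N (X.smulShortComplex x).X₃ i,
          e.comp hS.extClass rfl = 0 → e = 0 := by
      intro N i hN e he
      obtain ⟨e', rfl⟩ := Ext.covariant_sequence_exact₃ N hS e rfl he
      obtain rfl : e' = 0 := hN.elim _ _
      exact Ext.zero_comp ..
    have h := ih (ModuleCat.of R (QuotSMulTop x X)) (a - 1) (by omega)
      (fun i hi ↦ subsingleton_of_forall_eq 0 fun e ↦ shift C i (hC i (by omega)) e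
        ((hC (i + 1) (by omega)).elim _ _))
      (fun i hi ↦ subsingleton_of_forall_eq 0 fun e ↦ shift K i (hK i (by omega)) e
        ((hK (i + 1) (by omega)).elim _ _))
      (fun r hr e ↦ shift K k (hK k (by omega)) _ ((Ext.smul_comp _ _ _ _).trans (hann r hr _)))
    refine subsingleton_of_forall_eq 0 fun e ↦ ?_
    have hxe : e.comp (Ext.mk₀ (x • 𝟙 X)) (add_zero (k + 1)) = 0 := by
      rw [Ext.mk₀_smul, Ext.comp_smul, Ext.comp_mk₀_id]
      exact smul_ext_eq_zero_of_mem_annihilator hx e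
    obtain ⟨e', rfl⟩ := Ext.covariant_sequence_exact₁ K hS e
      hxe rfl
    obtain rfl : e' = 0 := h.elim _ _
    exact Ext.zero_comp ..

section depth

lemma annihilator_le_maximalIdeal {R : Type*} [CommRing R] [IsLocalRing R]
    (N : Type*) [AddCommGroup N] [Module R N] [Nontrivial N] :
    Module.annihilator R N ≤ maximalIdeal R :=
  le_maximalIdeal fun h ↦ not_subsingleton N (Module.annihilator_eq_top_iff.mp h)

variable {R : Type u} [CommRing R] [IsNoetherianRing R] [IsLocalRing R]

lemma length_le_rdepth {rs : List R} (hmem : ∀ r ∈ rs, r ∈ maximalIdeal R)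
    (hreg : RingTheory.Sequence.IsRegular R rs) : rs.length ≤ rdepth R R := by
  refine le_csSup ?_ ⟨rs, rfl, hmem, hreg⟩
  obtain ⟨d, hd⟩ : ∃ d : ℕ, ringKrullDim R = d := by
    obtain ⟨d, hd⟩ := WithBot.ne_bot_iff_exists.mp (ringKrullDim_ne_bot (R := R))
    have hd' : d ≠ ⊤ := fun h ↦ ringKrullDim_ne_top (R := R) (by rw [← hd, h]; rfl)
    obtain ⟨d, rfl⟩ := ENat.ne_top_iff_exists.mp hd'
    exact ⟨d, hd.symm⟩
  refine ⟨d, ?_⟩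
  rintro _ ⟨rs, rfl, -, hreg⟩
  have hlen := ringKrullDim_add_length_eq_ringKrullDim_of_isRegular rs hreg
  have : Nontrivial (R ⧸ Ideal.ofList rs) :=
    Ideal.Quotient.nontrivial_iff.mpr fun h ↦ hreg.top_ne_smul (by simp [h])
  rw [hd] at hlen
  have hle : (rs.length : WithBot ℕ∞) ≤ d := by
    rw [← hlen]
    exact le_add_of_nonneg_left ringKrullDim_nonneg_of_nontrivial
  exact_mod_cast hle

lemma exists_isRegular_mem_annihilator (N : Type u) [AddCommGroup N] [Module R N]
    [Module.Finite R N] [Nontrivial N] (n : ℕ)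
    (h : ∀ i < n, Subsingleton
      (CategoryTheory.Abelian.Ext (ModuleCat.of R N) (ModuleCat.of R R) i)) :
    ∃ rs : List R, rs.length = n ∧ (∀ r ∈ rs, r ∈ Module.annihilator R N) ∧
      RingTheory.Sequence.IsRegular R rs := by
  refine ModuleCat.exists_isRegular_of_exists_subsingleton_ext (Module.annihilator R N) n
    (ModuleCat.of R R) ?_ (ModuleCat.of R N) (Module.support_eq_zeroLocus ..) h
  refine lt_top_iff_ne_top.mpr fun htop ↦ Ideal.IsPrime.ne_top' (I := maximalIdeal R) ?_
  rw [Ideal.smul_top_eq_map] at htop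
  refine top_le_iff.mp (le_trans ?_ (annihilator_le_maximalIdeal N))
  simpa using htop.ge

lemma subsingleton_of_subsingleton_ext (N : Type u) [AddCommGroup N] [Module R N]
    [Module.Finite R N]
    (h : ∀ i ≤ rdepth R R, Subsingleton
      (CategoryTheory.Abelian.Ext (ModuleCat.of R N) (ModuleCat.of R R) i)) :
    Subsingleton N := by
  by_contra hN
  rw [not_subsingleton_iff_nontrivial] at hN
  obtain ⟨rs, hlen, hmem, hreg⟩ := exists_isRegular_mem_annihilator N (rdepth R R + 1)
    fun i hi ↦ h i (by omega)
  have := length_le_rdepth (fun r hr ↦ annihilator_le_maximalIdeal N (hmem r hr)) hreg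
  omega

lemma isFiniteLength_of_subsingleton_ext (N : Type u) [AddCommGroup N] [Module R N]
    [Module.Finite R N]
    (h : ∀ i < rdepth R R, Subsingleton
      (CategoryTheory.Abelian.Ext (ModuleCat.of R N) (ModuleCat.of R R) i))
    (hdim : ringKrullDim R = (rdepth R R : WithBot (WithTop ℕ))) :
    IsFiniteLength R N := by
  cases subsingleton_or_nontrivial N
  · exact .of_subsingleton
  obtain ⟨rs, hlen, hmem, hreg⟩ := exists_isRegular_mem_annihilator N (rdepth R R) h
  have hdim' := ringKrullDim_add_length_eq_ringKrullDim_of_isRegular rs hreg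
  rw [hlen, hdim] at hdim'
  have : Ring.KrullDimLE 0 (R ⧸ Ideal.ofList rs) := Ring.krullDimLE_iff.mpr (by
    refine le_of_eq (ENat.WithBot.add_natCast_cancel (c := rdepth R R) |>.mp ?_)
    exact hdim'.trans (by rw [Nat.cast_zero, zero_add]; rfl))
  have : IsArtinianRing (R ⧸ Ideal.ofList rs) :=
    IsNoetherianRing.isArtinianRing_of_krullDimLE_zero
  have hann : Ideal.ofList rs ≤ Module.annihilator R N := Ideal.span_le.mpr hmem
  have htors : Module.IsTorsionBySet R N (Ideal.ofList rs) :=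
    fun x r ↦ Module.mem_annihilator.mp (hann r.2) x
  let := htors.module
  have : IsScalarTower R (R ⧸ Ideal.ofList rs) N := htors.isScalarTower
  have : Module.Finite (R ⧸ Ideal.ofList rs) N := .of_restrictScalars_finite R _ N
  exact isFiniteLength_iff_isNoetherian_isArtinian.mpr ⟨inferInstance,
    isArtinian_of_surjective_algebraMap (R := R ⧸ Ideal.ofList rs) Ideal.Quotient.mk_surjective⟩

end depth

section dual

open CategoryTheory Abelian

variable {R : Type u} [CommRing R] [IsNoetherianRing R] [IsLocalRing R]

/-- Let `φ : M → F` with `F` finite free induce a bijection on duals, where `Ext^i(M, R) = 0` for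
`1 ≤ i ≤ depth R - 1`. Then `φ` is surjective, and `Ext^i(ker φ, R) = 0` for `i < depth R`. -/
lemma surjective_and_subsingleton_ext_ker_of_dualMap_bijective {M F : Type u}
    [AddCommGroup M] [Module R M] [Module.Finite R M]
    [AddCommGroup F] [Module R F] [Module.Finite R F] [Module.Free R F]
    (φ : M →ₗ[R] F) (hφ : Function.Bijective φ.dualMap)
    (hM : ∀ i, 1 ≤ i → i ≤ rdepth R R - 1 →
      Subsingleton (Ext (ModuleCat.of R M) (ModuleCat.of R R) i)) :
    Function.Surjective φ ∧ ∀ i < rdepth R R,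
      Subsingleton (Ext (ModuleCat.of R φ.ker) (ModuleCat.of R R) i) := by
  let X := ModuleCat.of R R
  let S₁ : ShortComplex (ModuleCat.{u} R) := ModuleCat.shortComplexOfCompEqZero
    φ.range.subtype φ.range.mkQ (by ext; simp)
  let S₂ : ShortComplex (ModuleCat.{u} R) := ModuleCat.shortComplexOfCompEqZero
    φ.ker.subtype φ.rangeRestrict (by ext x; simp)
  have h₁ : S₁.ShortExact :=
    ModuleCat.shortComplex_shortExact _ (LinearMap.exact_subtype_mkQ _)
      (Submodule.subtype_injective _) (Submodule.mkQ_surjective _)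
  have h₂ : S₂.ShortExact :=
    ModuleCat.shortComplex_shortExact _
      (fun x ↦ Subtype.ext_iff.trans (LinearMap.exact_subtype_ker_map φ x))
      (Submodule.subtype_injective _) φ.surjective_rangeRestrict
  have : Projective S₁.X₂ := (IsProjective.iff_projective F).mp inferInstance
  have hF : ∀ i, Subsingleton (Ext S₁.X₂ X (i + 1)) := fun i ↦
    Ext.subsingleton_of_projective _ _ _
  -- every functional on `M` factors through `φ`
  have hfac : ∀ f : S₂.X₂ ⟶ X, ∃ g : S₁.X₂ ⟶ X, f = S₂.g ≫ S₁.f ≫ g := fun f ↦ by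
    obtain ⟨g, hg⟩ := hφ.2 f.hom
    exact ⟨ModuleCat.ofHom g, ModuleCat.hom_ext hg.symm⟩
  have hC₀ : Subsingleton (Ext S₁.X₃ X 0) := by
    rw [Ext.addEquiv₀.subsingleton_congr]
    refine subsingleton_of_forall_eq 0 fun f ↦ ?_
    have := h₁.epi_g
    rw [← cancel_epi S₁.g, Limits.comp_zero]
    refine ModuleCat.hom_ext (hφ.1 ?_)
    ext x
    have hx : φ.range.mkQ (φ x) = 0 := (Submodule.Quotient.mk_eq_zero _).mpr ⟨x, rfl⟩
    exact (congrArg f.hom hx).trans (map_zero _)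
  have hC₁ : Subsingleton (Ext S₁.X₃ X 1) := by
    refine subsingleton_of_forall_eq 0 fun e ↦ ?_
    obtain ⟨e', rfl⟩ := Ext.contravariant_sequence_exact₃ h₁ X e ((hF 0).elim _ _) (add_zero 1)
    obtain ⟨f, rfl⟩ := (Ext.mk₀_bijective _ _).2 e'
    obtain ⟨g, hg⟩ := hfac (S₂.g ≫ f)
    have := h₂.epi_g
    rw [cancel_epi] at hg
    rw [hg, ← Ext.mk₀_comp_mk₀, h₁.extClass_comp_assoc]
  -- the double connecting map `Ext^k(ker φ, R) → Ext^{k+2}(coker φ, R)` is injective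
  have hinj : ∀ k, k = 0 ∨ k ≤ rdepth R R - 1 → ∀ e : Ext S₂.X₁ X k,
      h₁.extClass.comp (h₂.extClass.comp e (add_comm 1 k)) (add_comm 1 (k + 1)) = 0 → e = 0 := by
    intro k hk e he
    obtain ⟨e₁, he₁⟩ := Ext.contravariant_sequence_exact₁ h₁ X _ (add_comm 1 (k + 1)) he
    obtain rfl : e₁ = 0 := (hF k).elim _ _
    rw [Ext.comp_zero] at he₁
    obtain ⟨e₂, rfl⟩ := Ext.contravariant_sequence_exact₁ h₂ X _ (add_comm 1 k) he₁.symm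
    obtain rfl | hk₀ := Nat.eq_zero_or_pos k
    · obtain ⟨f, rfl⟩ := (Ext.mk₀_bijective _ _).2 e₂
      obtain ⟨g, rfl⟩ := hfac f
      rw [Ext.mk₀_comp_mk₀, ← Category.assoc, S₂.zero, Limits.zero_comp, Ext.mk₀_zero]
    · obtain rfl : e₂ = 0 := (hM k hk₀ (by omega)).elim _ _
      rw [Ext.comp_zero]
  have hsurj : ∀ k, k + 2 ≤ rdepth R R → Subsingleton (Ext S₂.X₁ X k) →
      Subsingleton (Ext S₁.X₃ X (k + 2)) := by
    intro k hk hK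
    refine subsingleton_of_forall_eq 0 fun e ↦ ?_
    obtain ⟨e₁, rfl⟩ := Ext.contravariant_sequence_exact₃ h₁ X e ((hF (k + 1)).elim _ _)
      (add_comm 1 (k + 1))
    obtain ⟨e₂, rfl⟩ := Ext.contravariant_sequence_exact₃ h₂ X e₁
      ((hM (k + 1) (by omega) (by omega)).elim _ _) (add_comm 1 k)
    obtain rfl : e₂ = 0 := hK.elim _ _
    rw [Ext.comp_zero, Ext.comp_zero]
  have hann : ∀ k, k = 0 ∨ k ≤ rdepth R R - 1 → ∀ r ∈ Module.annihilator R S₁.X₃,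
      ∀ e : Ext S₂.X₁ X k, r • e = 0 := by
    intro k hk r hr e
    refine hinj k hk _ ?_
    rw [Ext.comp_smul, Ext.comp_smul]
    exact smul_ext_eq_zero_of_mem_annihilator hr _
  have : Module.Finite R S₁.X₃ := inferInstanceAs (Module.Finite R (F ⧸ φ.range))
  have : Module.Finite R S₂.X₁ := inferInstanceAs (Module.Finite R φ.ker)
  have hC : ∀ a ≤ rdepth R R, Subsingleton (Ext S₁.X₃ X a) := by
    intro a
    induction a using Nat.strong_induction_on with
    | _ a ih =>
      intro ha
      match a with
      | 0 => exact hC₀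
      | 1 => exact hC₁
      | a + 2 =>
        refine hsurj a ha ?_
        suffices ∀ k ≤ a, Subsingleton (Ext S₂.X₁ X k) from this a le_rfl
        intro k
        induction k using Nat.strong_induction_on with
        | _ k ihk =>
          intro hk
          have : Module.Finite R X := inferInstanceAs (Module.Finite R R)
          exact subsingleton_ext_of_annihilator_smul_eq_zero S₁.X₃ S₂.X₁ k X (a + 2) (by omega)
            (fun i hi ↦ ih i hi (by omega)) (fun i hi ↦ ihk i hi (by omega))
            (hann k (by omega))
  have hC' : Subsingleton (F ⧸ φ.range) := subsingleton_of_subsingleton_ext _ hC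
  refine ⟨LinearMap.range_eq_top.mp (Submodule.Quotient.subsingleton_iff.mp hC'),
    fun i hi ↦ subsingleton_of_forall_eq 0 fun e ↦ ?_⟩
  have h1 : (1 : R) ∈ Module.annihilator R S₁.X₃ :=
    Module.mem_annihilator.mpr fun x ↦ hC'.elim _ _
  simpa using hann i (by omega) 1 h1 e

end dual

/-- Let `(R, m)` be a commutative Noetherian local ring of depth `t` and `M` a
finitely generated `R`-module with `Ext^i_R(M, R) = 0` for `1 ≤ i ≤ t−1`.  If `M^*` is free, then
`M ≅ T ⊕ M^*` for some finitely generated `T` which is either `0` or has grade `t`; if moreover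
`R` is Cohen–Macaulay (i.e. `depth(R)` equals the Krull dimension of `R`), then `T` has finite
length. -/
theorem decomposition_of_dual_free {R : Type u} [CommRing R] [IsNoetherianRing R] [IsLocalRing R]
    (M : Type u) [AddCommGroup M] [Module R M] [Module.Finite R M]
    (hvanish : ∀ i : ℕ, 1 ≤ i → i ≤ rdepth R R - 1 → Subsingleton (extModule R M R i))
    (hfree : Module.Free R (M →ₗ[R] R)) :
    ∃ (T : Type u) (_ : AddCommGroup T) (_ : Module R T) (_ : Module.Finite R T),
      Nonempty (M ≃ₗ[R] (T × (M →ₗ[R] R))) ∧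
      (Subsingleton T ∨ gradeOf R T = rdepth R R) ∧
      (ringKrullDim R = (rdepth R R : WithBot (WithTop ℕ)) → IsFiniteLength R T) := by
  have hbij : Function.Bijective (Module.Dual.eval R M).dualMap := by
    have : Function.LeftInverse (Module.Dual.eval R M).dualMap
        (Module.Dual.eval R (M →ₗ[R] R)) := fun f ↦ by ext; rfl
    have hev := Module.bijective_dual_eval R (M →ₗ[R] R)
    exact (Function.Bijective.of_comp_iff _ hev).mp (this.comp_eq_id ▸ Function.bijective_id)
  obtain ⟨hsurj, hker⟩ := surjective_and_subsingleton_ext_ker_of_dualMap_bijective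
    (Module.Dual.eval R M) hbij
    fun i h₁ h₂ ↦ (subsingleton_extModule_iff M R i).mp (hvanish i h₁ h₂)
  refine ⟨(Module.Dual.eval R M).ker, _, _,
    (inferInstance : Module.Finite R (Module.Dual.eval R M).ker), ?_, ?_,
    isFiniteLength_of_subsingleton_ext (Module.Dual.eval R M).ker hker⟩
  · obtain ⟨s, hs⟩ := Module.projective_lifting_property _ LinearMap.id hsurj
    classical
    exact ⟨((LinearMap.exact_subtype_ker_map _).splitSurjectiveEquiv
      (Submodule.subtype_injective _) ⟨s, hs⟩).1.trans <|
        .prodCongr (.refl R _) (Module.Free.chooseBasis R (M →ₗ[R] R)).toDualEquiv.symm⟩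
  · refine or_iff_not_imp_left.mpr fun hT ↦ ?_
    have hne : ¬ Subsingleton (extModule R (Module.Dual.eval R M).ker R (rdepth R R)) := by
      refine fun h ↦ hT (subsingleton_of_subsingleton_ext (R := R) _ fun i hi ↦ ?_)
      obtain hi | rfl := hi.lt_or_eq
      · exact hker i hi
      · exact (subsingleton_extModule_iff _ _ _).mp h
    refine le_antisymm (Nat.sInf_le hne) (le_csInf ⟨_, hne⟩ fun i hi ↦ ?_)
    by_contra! hlt
    exact hi ((subsingleton_extModule_iff _ _ _).mpr (hker i hlt))
end
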